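/- arXiv:1510.06519 — 2 statements merged into one kernel-verified Lean document; each statement's English description precedes it below -/
import Mathlib

section
/- Let n, m ≥ 1, let v_1, …, v_m ∈ C^{⊗n}(A) be points with associated polynomials f_{v_1}, …, f_{v_m} ∈ A[t], and let a_1, …, a_m ∈ 𝔽_q[t]. Put F := Σ_{i=1}^m a_i · f_{v_i} ∈ A[t]. Then Σ_{i=1}^m a_i · v_i = 0 in the 𝔽_q[t]-module C^{⊗n}(A) if and only if there exists δ ∈ A[t] with (q−1)·deg_θ δ ≤ max{(q−1)·deg_θ F, nq} satisfying δ·(t−θ^q)^n + F·(t−θ^q)^n = δ^{(1)}. In particular, whether a given 𝔽_q[t]-linear relation holds among v_1, …, v_m is decided by an explicit finite system of 𝔽_q[t]-linear equations, so the rank of the 𝔽_q[t]-submodule generated by v_1, …, v_m can be computed effectively. -/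
open Polynomial

/-- The `𝔽_q`-linear endomorphism `φ_t` of `A^n` (with `A = 𝔽_q[θ]`) giving the
`t`-action on the `n`-th tensor power of the Carlitz module:
`(φ_t v)_i = θ v_i + v_{i+1}` for `i < n - 1` and `(φ_t v)_{n-1} = θ v_{n-1} + v_0^q`. -/
noncomputable def carlitzT (Fq : Type) [Field Fq] [Fintype Fq] (n : ℕ) :
    (Fin n → Polynomial Fq) →ₗ[Fq] (Fin n → Polynomial Fq) where
  toFun v i := Polynomial.X * v i +
    (if h : (i : ℕ) + 1 < n then v ⟨(i : ℕ) + 1, h⟩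
     else v ⟨0, i.pos⟩ ^ Fintype.card Fq)
  map_add' v w := by
    obtain ⟨p, hp⟩ := CharP.exists Fq
    haveI := hp
    obtain ⟨m, hpp, hcard⟩ := FiniteField.card Fq p
    haveI : Fact p.Prime := ⟨hpp⟩
    funext i
    by_cases h : (i : ℕ) + 1 < n
    · simp only [Pi.add_apply, dif_pos h]
      ring
    · simp only [Pi.add_apply, dif_neg h, hcard, add_pow_char_pow]
      ring
  map_smul' a v := by
    funext i
    by_cases h : (i : ℕ) + 1 < n
    · simp only [Pi.smul_apply, dif_pos h, RingHom.id_apply, smul_eq_C_mul]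
      ring
    · simp only [Pi.smul_apply, dif_neg h, RingHom.id_apply, smul_eq_C_mul, mul_pow,
        ← Polynomial.C_pow, FiniteField.pow_card]
      ring

/-- `C^{⊗n}(A)`, the `𝔽_q[t]`-module of `A`-valued points of the `n`-th tensor
power of the Carlitz module: the underlying space is `A^n` and the variable of
`𝔽_q[t]` (here `Polynomial.X`) acts by `carlitzT`. -/
noncomputable abbrev CarlitzTensorPoints (Fq : Type) [Field Fq] [Fintype Fq] (n : ℕ) :=
  Module.AEval' (carlitzT Fq n)

/-- The polynomial `f_v = v_1 (t-θ)^{n-1} + v_2 (t-θ)^{n-2} + ⋯ + v_n ∈ A[t]`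
associated to a point `v = (v_1, …, v_n)ᵀ ∈ A^n`.  Here `A[t]` is realized as
polynomials in the (outer) variable `t` with coefficients in `A = Polynomial Fq`. -/
noncomputable def assocPoly (Fq : Type) [Field Fq] (n : ℕ)
    (v : Fin n → Polynomial Fq) : Polynomial (Polynomial Fq) :=
  ∑ i : Fin n, Polynomial.C (v i) *
    (Polynomial.X - Polynomial.C Polynomial.X) ^ (n - 1 - (i : ℕ))

/-- The Frobenius twist on `A[t]`: if `g = Σᵢ uᵢ tⁱ` with `uᵢ ∈ A`, then
`g⁽¹⁾ = Σᵢ uᵢ^q tⁱ`. -/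
noncomputable def frobTwist (Fq : Type) [Field Fq] [Fintype Fq]
    (g : Polynomial (Polynomial Fq)) : Polynomial (Polynomial Fq) :=
  g.sum fun i u => Polynomial.C (u ^ Fintype.card Fq) * Polynomial.X ^ i

/-- The `θ`-degree of `g = Σᵢ uᵢ tⁱ ∈ A[t]`: the maximum of the `θ`-degrees of
the coefficients `uᵢ ∈ A = 𝔽_q[θ]`. -/
noncomputable def degTheta (Fq : Type) [Field Fq]
    (g : Polynomial (Polynomial Fq)) : ℕ :=
  g.support.sup fun i => (g.coeff i).natDegree

noncomputable def frobA (Fq : Type) [Field Fq] [Fintype Fq] : Polynomial Fq →+* Polynomial Fq :=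
  (FiniteField.frobeniusAlgHom Fq (Polynomial Fq)).toRingHom

lemma frobA_apply (Fq : Type) [Field Fq] [Fintype Fq] (u : Polynomial Fq) :
    frobA Fq u = u ^ Fintype.card Fq := rfl

lemma frobA_inj (Fq : Type) [Field Fq] [Fintype Fq] : Function.Injective (frobA Fq) := by
  rw [injective_iff_map_eq_zero]
  intro u hu
  rw [frobA_apply] at hu
  exact eq_zero_of_pow_eq_zero hu

lemma frobTwist_eq_map (Fq : Type) [Field Fq] [Fintype Fq] (g : Polynomial (Polynomial Fq)) :
    frobTwist Fq g = g.map (frobA Fq) := by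
  rw [frobTwist, Polynomial.map, Polynomial.eval₂_eq_sum]
  rfl

noncomputable def psi (Fq : Type) [Field Fq] [Fintype Fq] (n : ℕ)
    (g : Polynomial (Polynomial Fq)) : Polynomial (Polynomial Fq) :=
  g.map (frobA Fq) - (X - C X) ^ n * g

lemma psi_add (Fq : Type) [Field Fq] [Fintype Fq] (n : ℕ)
    (g h : Polynomial (Polynomial Fq)) : psi Fq n (g + h) = psi Fq n g + psi Fq n h := by
  simp only [psi, Polynomial.map_add]; ring

lemma psi_sub (Fq : Type) [Field Fq] [Fintype Fq] (n : ℕ)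
    (g h : Polynomial (Polynomial Fq)) : psi Fq n (g - h) = psi Fq n g - psi Fq n h := by
  simp only [psi, Polynomial.map_sub]; ring

lemma map_C_frob (Fq : Type) [Field Fq] [Fintype Fq] (a : Polynomial Fq) :
    (a.map (C : Fq →+* Polynomial Fq)).map (frobA Fq) = a.map C := by
  rw [Polynomial.map_map]
  congr 1
  ext1 c
  rw [RingHom.comp_apply, frobA_apply, ← C_pow, FiniteField.pow_card]

lemma psi_mul (Fq : Type) [Field Fq] [Fintype Fq] (n : ℕ) (a : Polynomial Fq)
    (g : Polynomial (Polynomial Fq)) :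
    psi Fq n (a.map C * g) = a.map C * psi Fq n g := by
  simp only [psi, Polynomial.map_mul, map_C_frob]; ring

lemma psi_sum (Fq : Type) [Field Fq] [Fintype Fq] (n : ℕ) {ι : Type} (s : Finset ι)
    (g : ι → Polynomial (Polynomial Fq)) :
    psi Fq n (∑ i ∈ s, g i) = ∑ i ∈ s, psi Fq n (g i) := by
  simp only [psi, Polynomial.map_sum, Finset.mul_sum, Finset.sum_sub_distrib]

lemma assoc_add (Fq : Type) [Field Fq] (n : ℕ) (v w : Fin n → Polynomial Fq) :
    assocPoly Fq n (v + w) = assocPoly Fq n v + assocPoly Fq n w := by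
  simp only [assocPoly, Pi.add_apply, C_add, add_mul, Finset.sum_add_distrib]

lemma assoc_zero (Fq : Type) [Field Fq] (n : ℕ) :
    assocPoly Fq n 0 = 0 := by
  simp [assocPoly]

lemma assoc_sum (Fq : Type) [Field Fq] (n : ℕ) {ι : Type} (s : Finset ι)
    (v : ι → Fin n → Polynomial Fq) :
    assocPoly Fq n (∑ i ∈ s, v i) = ∑ i ∈ s, assocPoly Fq n (v i) := by
  classical
  induction s using Finset.induction_on with
  | empty => simp [assoc_zero]
  | insert a s ha ih => rw [Finset.sum_insert ha, Finset.sum_insert ha, assoc_add, ih]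

lemma assoc_smul (Fq : Type) [Field Fq] (n : ℕ) (c : Fq) (v : Fin n → Polynomial Fq) :
    assocPoly Fq n (c • v) = C (C c) * assocPoly Fq n v := by
  simp only [assocPoly, Pi.smul_apply, smul_eq_C_mul, C_mul, Finset.mul_sum, mul_assoc]

lemma assoc_T (Fq : Type) [Field Fq] [Fintype Fq] (k : ℕ) (v : Fin (k+1) → Polynomial Fq) :
    assocPoly Fq (k+1) (carlitzT Fq (k+1) v) - X * assocPoly Fq (k+1) v
      = psi Fq (k+1) (C (v 0)) := by
  have h1 : assocPoly Fq (k+1) (carlitzT Fq (k+1) v) = C X * assocPoly Fq (k+1) v +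
      ((∑ i : Fin k, C (v i.succ) * (X - C X) ^ (k - (i:ℕ))) + C (v 0 ^ Fintype.card Fq)) := by
    have : ∀ i, carlitzT Fq (k+1) v i = X * v i + (if h : (i : ℕ) + 1 < k+1 then v ⟨(i : ℕ) + 1, h⟩
     else v ⟨0, i.pos⟩ ^ Fintype.card Fq) := fun i => rfl
    simp only [assocPoly, this, C_add, add_mul, Finset.sum_add_distrib, C_mul, Finset.mul_sum,
      mul_assoc]
    refine congrArg₂ (· + ·) rfl ?_
    rw [Fin.sum_univ_castSucc]
    refine congrArg₂ (· + ·) ?_ ?_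
    · refine Finset.sum_congr rfl fun i _ => ?_
      rw [dif_pos (by simp)]
      rfl
    · rw [dif_neg (by simp)]
      simp
  have h2 : (X - C X) * assocPoly Fq (k+1) v = C (v 0) * (X - C X) ^ (k+1) +
      ∑ i : Fin k, C (v i.succ) * (X - C X) ^ (k - (i:ℕ)) := by
    rw [assocPoly, Fin.sum_univ_succ, mul_add, Finset.mul_sum]
    refine congrArg₂ (· + ·) ?_ ?_
    · have h0 : k + 1 - 1 - ((0 : Fin (k+1)) : ℕ) = k := by simp
      rw [h0, pow_succ]; ring
    · refine Finset.sum_congr rfl fun i _ => ?_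
      have : k - (i:ℕ) = (k + 1 - 1 - (i.succ : ℕ)) + 1 := by
        have := i.2
        simp; omega
      rw [this]; ring
  have h3 : psi Fq (k+1) (C (v 0)) =
      C (v 0 ^ Fintype.card Fq) - (X - C X) ^ (k+1) * C (v 0) := by
    rw [psi, map_C, frobA_apply]
  rw [h1, h3]
  linear_combination -h2

lemma assoc_aeval (Fq : Type) [Field Fq] [Fintype Fq] (k : ℕ) (a : Polynomial Fq) :
    ∀ v : Fin (k+1) → Polynomial Fq, ∃ g,
    assocPoly Fq (k+1) (aeval (carlitzT Fq (k+1)) a v) - a.map C * assocPoly Fq (k+1) v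
      = psi Fq (k+1) g := by
  induction a using Polynomial.induction_on with
  | C c =>
    intro v
    refine ⟨0, ?_⟩
    rw [aeval_C, Module.algebraMap_end_apply, assoc_smul, map_C]
    simp [psi]
  | add p q hp hq =>
    intro v
    obtain ⟨g, hg⟩ := hp v
    obtain ⟨h, hh⟩ := hq v
    refine ⟨g + h, ?_⟩
    rw [psi_add, ← hg, ← hh, map_add, LinearMap.add_apply, assoc_add, Polynomial.map_add]
    ring
  | monomial m c ih =>
    intro v
    obtain ⟨g, hg⟩ := ih (carlitzT Fq (k+1) v)
    refine ⟨g + (C c * X ^ m : Polynomial Fq).map C * C (v 0), ?_⟩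
    rw [psi_add, psi_mul, ← assoc_T, ← hg, pow_succ, ← mul_assoc, map_mul, aeval_X,
      Module.End.mul_apply, Polynomial.map_mul, map_X]
    ring

lemma assoc_degree (Fq : Type) [Field Fq] (k : ℕ) (v : Fin (k+1) → Polynomial Fq) :
    (assocPoly Fq (k+1) v).natDegree ≤ k := by
  refine natDegree_sum_le_of_forall_le _ _ fun i _ => ?_
  refine (natDegree_C_mul_le _ _).trans ?_
  rw [natDegree_pow, natDegree_X_sub_C]
  omega

lemma assoc_inj (Fq : Type) [Field Fq] (k : ℕ) (v : Fin (k+1) → Polynomial Fq)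
    (h : assocPoly Fq (k+1) v = 0) : v = 0 := by
  have h2 : (assocPoly Fq (k+1) v).comp (X + C X) = ∑ i : Fin (k+1), C (v i) * X ^ (k - (i:ℕ)) := by
    simp [assocPoly, Polynomial.sum_comp]
  rw [h, zero_comp] at h2
  funext j
  have h3 := congrArg (fun p => coeff p (k - (j:ℕ))) h2
  simp only [coeff_zero, finsetSum_coeff, coeff_C_mul, coeff_X_pow] at h3
  rw [Finset.sum_eq_single j] at h3
  · simpa using h3.symm
  · intro b _ hb
    rw [if_neg, mul_zero]
    intro h
    apply hb
    ext
    omega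
  · simp

lemma psi_small (Fq : Type) [Field Fq] [Fintype Fq] (k : ℕ) (g : Polynomial (Polynomial Fq))
    (h : (psi Fq (k+1) g).natDegree ≤ k) : g = 0 := by
  by_contra hg
  have hm : ((X - C X : Polynomial (Polynomial Fq)) ^ (k+1)).Monic := (monic_X_sub_C _).pow _
  have h1 : ((X - C X) ^ (k+1) * g).natDegree = k + 1 + g.natDegree := by
    rw [hm.natDegree_mul' hg, natDegree_pow, natDegree_X_sub_C, mul_one]
  have h2 : (g.map (frobA Fq)).natDegree ≤ g.natDegree := natDegree_map_le
  have h3 : (psi Fq (k+1) g).natDegree = k + 1 + g.natDegree := by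
    rw [psi, natDegree_sub_eq_right_of_natDegree_lt (by omega), h1]
  omega

lemma twist_lin (Fq : Type) [Field Fq] [Fintype Fq] (n : ℕ) :
    ((X - C X : Polynomial (Polynomial Fq)) ^ n).map (frobA Fq) =
      (X - C (X ^ Fintype.card Fq)) ^ n := by
  rw [Polynomial.map_pow, Polynomial.map_sub, map_X, map_C, frobA_apply]

lemma diff_iff (Fq : Type) [Field Fq] [Fintype Fq] (n : ℕ) (F : Polynomial (Polynomial Fq)) :
    (∃ δ, δ * (X - C (X ^ Fintype.card Fq)) ^ n + F * (X - C (X ^ Fintype.card Fq)) ^ n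
      = frobTwist Fq δ) ↔ ∃ g, F = psi Fq n g := by
  have hm : ((X - C X : Polynomial (Polynomial Fq)) ^ n).Monic := (monic_X_sub_C _).pow _
  have hm' : ((X - C (X ^ Fintype.card Fq) : Polynomial (Polynomial Fq)) ^ n).Monic :=
    (monic_X_sub_C _).pow _
  constructor
  · rintro ⟨δ, h⟩
    rw [frobTwist_eq_map] at h
    have hd : (X - C X) ^ n ∣ δ := by
      rw [← Polynomial.map_dvd_map (frobA Fq) (frobA_inj Fq) hm, twist_lin, ← h]
      exact ⟨δ + F, by ring⟩
    obtain ⟨g, rfl⟩ := hd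
    refine ⟨g, ?_⟩
    rw [Polynomial.map_mul, twist_lin] at h
    apply mul_left_cancel₀ hm'.ne_zero
    rw [psi]
    linear_combination h
  · rintro ⟨g, rfl⟩
    refine ⟨(X - C X) ^ n * g, ?_⟩
    rw [frobTwist_eq_map, Polynomial.map_mul, twist_lin, psi]
    ring

lemma degTheta_le_iff (Fq : Type) [Field Fq] (g : Polynomial (Polynomial Fq)) (d : ℕ) :
    degTheta Fq g ≤ d ↔ ∀ i, (g.coeff i).natDegree ≤ d := by
  rw [degTheta, Finset.sup_le_iff]
  constructor
  · intro h i
    by_cases hi : i ∈ g.support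
    · exact h i hi
    · rw [notMem_support_iff.mp hi]; simp
  · intro h i _
    exact h i

lemma degTheta_mul (Fq : Type) [Field Fq] (g h : Polynomial (Polynomial Fq)) :
    degTheta Fq (g * h) ≤ degTheta Fq g + degTheta Fq h := by
  rw [degTheta_le_iff]
  intro i
  rw [coeff_mul]
  refine natDegree_sum_le_of_forall_le _ _ fun x _ => natDegree_mul_le.trans ?_
  exact add_le_add ((degTheta_le_iff Fq g _).1 le_rfl _) ((degTheta_le_iff Fq h _).1 le_rfl _)

lemma degTheta_add (Fq : Type) [Field Fq] (g h : Polynomial (Polynomial Fq)) :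
    degTheta Fq (g + h) ≤ max (degTheta Fq g) (degTheta Fq h) := by
  rw [degTheta_le_iff]
  intro i
  rw [coeff_add]
  refine (natDegree_add_le _ _).trans ?_
  exact max_le_max ((degTheta_le_iff Fq g _).1 le_rfl _) ((degTheta_le_iff Fq h _).1 le_rfl _)

lemma degTheta_pow (Fq : Type) [Field Fq] [Fintype Fq] (n : ℕ) :
    degTheta Fq ((X - C (X ^ Fintype.card Fq)) ^ n) ≤ n * Fintype.card Fq := by
  induction n with
  | zero =>
    rw [degTheta_le_iff]
    intro i
    rw [pow_zero, coeff_one]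
    split_ifs <;> simp
  | succ n ih =>
    rw [pow_succ, add_mul, one_mul]
    refine (degTheta_mul _ _ _).trans (add_le_add ih ?_)
    rw [degTheta_le_iff]
    intro i
    rw [coeff_sub, coeff_X, coeff_C]
    refine (natDegree_sub_le _ _).trans (max_le ?_ ?_)
    · split_ifs <;> simp
    · split_ifs <;> simp

lemma degTheta_twist (Fq : Type) [Field Fq] [Fintype Fq] (g : Polynomial (Polynomial Fq)) :
    Fintype.card Fq * degTheta Fq g ≤ degTheta Fq (frobTwist Fq g) := by
  have hq : 0 < Fintype.card Fq := Fintype.card_pos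
  rw [mul_comm, ← Nat.le_div_iff_mul_le hq, degTheta_le_iff]
  intro i
  rw [Nat.le_div_iff_mul_le hq, mul_comm, ← natDegree_pow, ← frobA_apply, ← coeff_map,
    ← frobTwist_eq_map]
  exact (degTheta_le_iff Fq _ _).1 le_rfl _

lemma degree_bound (Fq : Type) [Field Fq] [Fintype Fq] (n : ℕ) (F δ : Polynomial (Polynomial Fq))
    (h : δ * (X - C (X ^ Fintype.card Fq)) ^ n + F * (X - C (X ^ Fintype.card Fq)) ^ n
      = frobTwist Fq δ) :
    (Fintype.card Fq - 1) * degTheta Fq δ ≤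
          max ((Fintype.card Fq - 1) * degTheta Fq F) (n * Fintype.card Fq) := by
  rcases le_total (degTheta Fq δ) (degTheta Fq F) with hd | hd
  · exact le_max_of_le_left (Nat.mul_le_mul_left _ hd)
  · apply le_max_of_le_right
    have h1 := degTheta_twist Fq δ
    rw [← h, ← add_mul] at h1
    have h2 := degTheta_mul Fq (δ + F) ((X - C (X ^ Fintype.card Fq)) ^ n)
    have h3 := degTheta_add Fq δ F
    rw [max_eq_left hd] at h3
    have h4 := degTheta_pow Fq n
    rw [Nat.sub_mul, one_mul]
    omega

/-- Let `n, m ≥ 1`, let `v_1, …, v_m ∈ C^{⊗n}(A)` with associated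
polynomials `f_{v_i} ∈ A[t]`, let `a_1, …, a_m ∈ 𝔽_q[t]`, and put
`F = Σᵢ aᵢ f_{v_i} ∈ A[t]`.  Then `Σᵢ aᵢ • vᵢ = 0` in the `𝔽_q[t]`-module
`C^{⊗n}(A)` if and only if there is `δ ∈ A[t]` with
`(q-1)·deg_θ δ ≤ max{(q-1)·deg_θ F, nq}` satisfying
`δ(t-θ^q)^n + F(t-θ^q)^n = δ⁽¹⁾`; this reduces deciding the relation to an explicit
finite system of `𝔽_q[t]`-linear equations. -/
theorem carlitz_linear_relation_iff_difference_equation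
    (Fq : Type) [Field Fq] [Fintype Fq]
    (n m : ℕ) (hn : 1 ≤ n) (hm : 1 ≤ m)
    (v : Fin m → (Fin n → Polynomial Fq))
    (a : Fin m → Polynomial Fq)
    (F : Polynomial (Polynomial Fq))
    (hF : F = ∑ i, ((a i).map (Polynomial.C : Fq →+* Polynomial Fq)) *
      assocPoly Fq n (v i)) :
    (∑ i, a i • Module.AEval'.of (carlitzT Fq n) (v i) = 0) ↔
      ∃ δ : Polynomial (Polynomial Fq),
        (Fintype.card Fq - 1) * degTheta Fq δ ≤
          max ((Fintype.card Fq - 1) * degTheta Fq F) (n * Fintype.card Fq) ∧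
        δ * (Polynomial.X - Polynomial.C (Polynomial.X ^ Fintype.card Fq)) ^ n +
            F * (Polynomial.X - Polynomial.C (Polynomial.X ^ Fintype.card Fq)) ^ n =
          frobTwist Fq δ := by
  obtain ⟨k, rfl⟩ : ∃ k, n = k + 1 := ⟨n - 1, by omega⟩
  have hrel : (∑ i, a i • Module.AEval'.of (carlitzT Fq (k+1)) (v i) = 0) ↔
      ∑ i, aeval (carlitzT Fq (k+1)) (a i) (v i) = 0 := by
    rw [← (Module.AEval'.of (carlitzT Fq (k+1))).map_eq_zero_iff, map_sum]
    rfl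
  have key : ∃ g, assocPoly Fq (k+1) (∑ i, aeval (carlitzT Fq (k+1)) (a i) (v i)) - F
      = psi Fq (k+1) g := by
    choose g hg using fun i => assoc_aeval Fq k (a i) (v i)
    refine ⟨∑ i, g i, ?_⟩
    rw [psi_sum, assoc_sum, hF, ← Finset.sum_sub_distrib]
    exact Finset.sum_congr rfl fun i _ => hg i
  obtain ⟨g, hg⟩ := key
  have hF' : (∑ i, a i • Module.AEval'.of (carlitzT Fq (k+1)) (v i) = 0) ↔
      ∃ g, F = psi Fq (k+1) g := by
    rw [hrel]
    constructor
    · intro h0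
      rw [h0, assoc_zero] at hg
      refine ⟨0 - g, ?_⟩
      rw [psi_sub, ← hg]
      simp [psi]
    · rintro ⟨g', hg'⟩
      have h1 : assocPoly Fq (k+1) (∑ i, aeval (carlitzT Fq (k+1)) (a i) (v i))
          = psi Fq (k+1) (g + g') := by
        rw [psi_add, ← hg, ← hg']; ring
      have h2 := psi_small Fq k (g + g') (h1 ▸ assoc_degree Fq k _)
      apply assoc_inj
      rw [h1, h2]
      simp [psi]
  rw [hF', ← diff_iff]
  constructor
  · rintro ⟨δ, h⟩
    exact ⟨δ, degree_bound Fq (k+1) F δ h, h⟩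
  · rintro ⟨δ, _, h⟩
    exact ⟨δ, h⟩
end

section
/- Let n ≥ 1 and let δ, F ∈ A[t] with δ ≠ 0 satisfy δ·(t−θ^q)^n + F·(t−θ^q)^n = δ^{(1)}. Then either deg_θ δ ≤ deg_θ F (in particular F ≠ 0), or (q−1)·deg_θ δ = nq. Consequently (q−1)·deg_θ δ ≤ max{(q−1)·deg_θ F, nq}. -/
open Polynomial

theorem coeff_coeff_swap_aux {Fq : Type} [Field Fq] (g : Polynomial (Polynomial Fq)) (i j : ℕ) :
    ((Bivariate.swap (R := Fq) g).coeff i).coeff j = (g.coeff j).coeff i := by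
  induction g using Polynomial.induction_on' with
  | add p r hp hr => simp [hp, hr]
  | monomial m a =>
    rw [Bivariate.swap_monomial, coeff_mul_C, coeff_map, coeff_C_mul, coeff_X_pow, coeff_monomial]
    by_cases h : m = j
    · simp [h]
    · have h2 : ¬ j = m := fun e => h e.symm
      simp [h, h2]

theorem degTheta_eq_aux {Fq : Type} [Field Fq] (g : Polynomial (Polynomial Fq)) :
    degTheta Fq g = (Bivariate.swap (R := Fq) g).natDegree := by
  apply le_antisymm
  · unfold degTheta
    apply Finset.sup_le
    intro j hj
    by_cases h : g.coeff j = 0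
    · simp [h]
    apply le_natDegree_of_ne_zero
    intro h0
    have := coeff_coeff_swap_aux g (g.coeff j).natDegree j
    rw [h0] at this
    simp at this
    exact h (leadingCoeff_eq_zero.1 this.symm)
  · rw [natDegree_le_iff_coeff_eq_zero]
    intro N hN
    ext j
    rw [coeff_coeff_swap_aux, coeff_zero]
    by_cases h : g.coeff j = 0
    · simp [h]
    apply coeff_eq_zero_of_natDegree_lt
    refine lt_of_le_of_lt ?_ hN
    exact Finset.le_sup (f := fun i => (g.coeff i).natDegree) (mem_support_iff.2 h)

theorem coeff_frobTwist_aux {Fq : Type} [Field Fq] [Fintype Fq] (g : Polynomial (Polynomial Fq))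
    (i : ℕ) : (frobTwist Fq g).coeff i = g.coeff i ^ Fintype.card Fq := by
  unfold frobTwist
  rw [Polynomial.sum_def, finset_sum_coeff]
  simp only [coeff_C_mul_X_pow]
  rw [Finset.sum_ite_eq]
  split_ifs with h
  · rfl
  · rw [notMem_support_iff.1 h, zero_pow Fintype.card_ne_zero]

theorem degTheta_frobTwist_aux {Fq : Type} [Field Fq] [Fintype Fq]
    (g : Polynomial (Polynomial Fq)) :
    degTheta Fq (frobTwist Fq g) = Fintype.card Fq * degTheta Fq g := by
  have hs : (frobTwist Fq g).support = g.support := by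
    ext i
    simp [coeff_frobTwist_aux]
  unfold degTheta
  rw [hs]
  simp only [coeff_frobTwist_aux, natDegree_pow]
  exact (Finset.comp_sup_eq_sup_comp_of_is_total (fun x => Fintype.card Fq * x)
    (fun a b h => Nat.mul_le_mul_left _ h) (by simp)).symm

theorem degTheta_factor_aux {Fq : Type} [Field Fq] [Fintype Fq] :
    (Bivariate.swap (R := Fq) (Polynomial.X - Polynomial.C (Polynomial.X ^ Fintype.card Fq))).natDegree
      = Fintype.card Fq := by
  rw [map_sub, Bivariate.swap_Y, Bivariate.swap_C, Polynomial.map_pow, map_X,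
    natDegree_sub, natDegree_X_pow_sub_C]

/-- Let `n ≥ 1` and let `δ, F ∈ A[t]` with `δ ≠ 0` satisfy
`δ(t-θ^q)^n + F(t-θ^q)^n = δ⁽¹⁾`.  Then either `deg_θ δ ≤ deg_θ F` (in particular
`F ≠ 0`), or `(q-1)·deg_θ δ = nq`.  Consequently
`(q-1)·deg_θ δ ≤ max{(q-1)·deg_θ F, nq}`. -/
theorem siegel_degree_bound
    (Fq : Type) [Field Fq] [Fintype Fq]
    (n : ℕ) (hn : 1 ≤ n) (δ F : Polynomial (Polynomial Fq)) (hδ : δ ≠ 0)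
    (heq : δ * (Polynomial.X - Polynomial.C (Polynomial.X ^ Fintype.card Fq)) ^ n +
        F * (Polynomial.X - Polynomial.C (Polynomial.X ^ Fintype.card Fq)) ^ n =
      frobTwist Fq δ) :
    ((F ≠ 0 ∧ degTheta Fq δ ≤ degTheta Fq F) ∨
        (Fintype.card Fq - 1) * degTheta Fq δ = n * Fintype.card Fq) ∧
      (Fintype.card Fq - 1) * degTheta Fq δ ≤
        max ((Fintype.card Fq - 1) * degTheta Fq F) (n * Fintype.card Fq) := by
  have hq : 1 < Fintype.card Fq := Fintype.one_lt_card
  have key : degTheta Fq F < degTheta Fq δ ∨ F = 0 →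
      (Fintype.card Fq - 1) * degTheta Fq δ = n * Fintype.card Fq := by
    intro h
    have h1 : (Bivariate.swap (R := Fq) (δ + F)).natDegree = degTheta Fq δ := by
      rcases h with h | h
      · rw [degTheta_eq_aux, degTheta_eq_aux] at h
        rw [map_add, natDegree_add_eq_left_of_natDegree_lt h, degTheta_eq_aux]
      · rw [h, add_zero, degTheta_eq_aux]
    have hne : δ + F ≠ 0 := by
      intro h0
      rcases h with h | h
      · rw [h0] at h1
        simp at h1
        omega
      · rw [h, add_zero] at h0
        exact hδ h0
    have hP : (Polynomial.X - Polynomial.C (Polynomial.X ^ Fintype.card Fq) :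
        Polynomial (Polynomial Fq)) ≠ 0 := X_sub_C_ne_zero _
    have h2 := congrArg (degTheta Fq) heq
    rw [← add_mul, degTheta_frobTwist_aux, degTheta_eq_aux, map_mul, map_pow, natDegree_mul,
      natDegree_pow, degTheta_factor_aux, h1] at h2
    · rw [Nat.sub_mul, one_mul, ← h2]
      omega
    · exact (map_ne_zero_iff _ (AlgEquiv.injective _)).2 hne
    · apply pow_ne_zero
      exact (map_ne_zero_iff _ (AlgEquiv.injective _)).2 hP
  by_cases h : degTheta Fq F < degTheta Fq δ ∨ F = 0
  · exact ⟨Or.inr (key h), (key h).le.trans (le_max_right _ _)⟩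
  · push Not at h
    exact ⟨Or.inl ⟨h.2, h.1⟩, (Nat.mul_le_mul_left _ h.1).trans (le_max_left _ _)⟩
end
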